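/- arXiv:1701.07579 — 2 statements merged into one kernel-verified Lean document; each statement's English description precedes it below -/
import Mathlib

section
/- For every k ≥ 1 and every r ≥ 2, the smallest length B_n(k,r,2) of a (not necessarily systematic) linear binary (n,k,r,2) batch code and the smallest length P_n(k,r,2) of a (not necessarily systematic) linear binary (n,k,r,2) PIR code satisfy ⌈k/r⌉ + k ≥ B_n(k,r,2) ≥ P_n(k,r,2) ≥ ⌈k/(2r−1)⌉ + k. -/
/-- `R` is a recovery set for information coordinate `i` of the linear encoding `C`. -/
def IsRecoverySet {F : Type} [Field F] {k : ℕ} {ι : Type}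
    (C : (Fin k → F) →ₗ[F] (ι → F)) (i : Fin k) (R : Finset ι) : Prop :=
  ∀ x x' : Fin k → F, (∀ j ∈ R, C x j = C x' j) → x i = x' i

/-- `C` is an `(n,k,r,t)` batch code: every query of `t` (possibly repeated) information
coordinates is served by `t` pairwise disjoint recovery sets, each of size at most `r`. -/
def IsBatchCode {F : Type} [Field F] {k : ℕ} {ι : Type} (r t : ℕ)
    (C : (Fin k → F) →ₗ[F] (ι → F)) : Prop :=
  Function.Injective C ∧
    ∀ q : Fin t → Fin k, ∃ R : Fin t → Finset ι,
      (∀ l₁ l₂ : Fin t, l₁ ≠ l₂ → Disjoint (R l₁) (R l₂)) ∧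
      (∀ l : Fin t, (R l).card ≤ r) ∧
      (∀ l : Fin t, IsRecoverySet C (q l) (R l))

/-- `C` is an `(n,k,r,t)` PIR code: every query `(x_i, …, x_i)` of size `t` is served by
`t` pairwise disjoint recovery sets for `i`, each of size at most `r`. -/
def IsPIRCode {F : Type} [Field F] {k : ℕ} {ι : Type} (r t : ℕ)
    (C : (Fin k → F) →ₗ[F] (ι → F)) : Prop :=
  Function.Injective C ∧
    ∀ i : Fin k, ∃ R : Fin t → Finset ι,
      (∀ l₁ l₂ : Fin t, l₁ ≠ l₂ → Disjoint (R l₁) (R l₂)) ∧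
      (∀ l : Fin t, (R l).card ≤ r) ∧
      (∀ l : Fin t, IsRecoverySet C i (R l))

/-- `C` is systematic: the information vector appears in the first `k` coordinates. -/
def IsSystematic {F : Type} [Field F] {k n : ℕ}
    (C : (Fin k → F) →ₗ[F] (Fin n → F)) : Prop :=
  ∀ x : Fin k → F, ∀ i : Fin k, ∃ h : (i : ℕ) < n, C x ⟨i, h⟩ = x i


section LowerBound

variable {F : Type} [Field F] {k : ℕ} {ι : Type}

/-- The functional reading off the `j`-th coordinate of the codeword. -/
def codeFunctional (C : (Fin k → F) →ₗ[F] (ι → F)) (j : ι) : Module.Dual F (Fin k → F) :=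
  LinearMap.proj j ∘ₗ C

theorem IsRecoverySet.exists_linearCombination_eq_proj {C : (Fin k → F) →ₗ[F] (ι → F)}
    {i : Fin k} {R : Finset ι} (h : IsRecoverySet C i R) :
    ∃ l ∈ Finsupp.supported F F (R : Set ι),
      Finsupp.linearCombination F (codeFunctional C) l = LinearMap.proj i := by
  have hspan : (LinearMap.proj i : Module.Dual F (Fin k → F)) ∈
      Submodule.span F (codeFunctional C '' (R : Set ι)) := by
    rw [Set.image_eq_range]
    refine mem_span_of_iInf_ker_le_ker fun x hx => ?_
    simp only [Submodule.mem_iInf, LinearMap.mem_ker, Subtype.forall] at hx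
    have hx' := h x 0 fun j hj => by simpa [codeFunctional] using hx j (by simpa using hj)
    simpa using hx'
  exact (Finsupp.mem_span_image_iff_linearCombination F).1 hspan

/-- A relation among the functionals of the code whose support has at most `2 * r` elements
and contains a recovery set. -/
theorem IsPIRCode.exists_relation {C : (Fin k → F) →ₗ[F] (ι → F)} {r : ℕ}
    (h : IsPIRCode r 2 C) (i : Fin k) :
    ∃ w : ι →₀ F, Finsupp.linearCombination F (codeFunctional C) w = 0 ∧
      w.support.card ≤ 2 * r ∧
      ∃ l : ι →₀ F, l.support ⊆ w.support ∧
        Finsupp.linearCombination F (codeFunctional C) l = LinearMap.proj i := by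
  classical
  obtain ⟨R, hdisj, hcard, hrec⟩ := h.2 i
  obtain ⟨l₀, hs₀, hl₀⟩ := (hrec 0).exists_linearCombination_eq_proj
  obtain ⟨l₁, hs₁, hl₁⟩ := (hrec 1).exists_linearCombination_eq_proj
  rw [Finsupp.mem_supported, Finset.coe_subset] at hs₀ hs₁
  have hd : Disjoint l₀.support l₁.support :=
    (hdisj 0 1 (by decide)).mono hs₀ hs₁
  refine ⟨l₀ - l₁, by rw [map_sub, hl₀, hl₁, sub_self], ?_, l₀, fun j hj => ?_, hl₀⟩
  · calc (l₀ - l₁).support.card ≤ (l₀.support ∪ l₁.support).card :=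
          Finset.card_le_card Finsupp.support_sub
      _ ≤ l₀.support.card + l₁.support.card := Finset.card_union_le _ _
      _ ≤ r + r := add_le_add ((Finset.card_le_card hs₀).trans (hcard 0))
          ((Finset.card_le_card hs₁).trans (hcard 1))
      _ = 2 * r := (two_mul r).symm
  · have hj₁ : l₁ j = 0 := Finsupp.notMem_support_iff.1 (Finset.disjoint_left.1 hd hj)
    simpa [hj₁] using hj

/-- If combinations of vectors indexed by `T` fill the whole space, then at most
`#T - dim V` relations supported on `T` are linearly independent. -/
theorem finrank_add_card_le_card_of_relations {V : Type} [AddCommGroup V] [Module F V]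
    (c : ι → V) (T : Finset ι) (b : Finset (ι →₀ F))
    (hb : LinearIndependent F ((↑) : b → ι →₀ F))
    (hker : ∀ w ∈ b, Finsupp.linearCombination F c w = 0)
    (hT : ∀ w ∈ b, w.support ⊆ T)
    (hspan : (⊤ : Submodule F V) ≤
      (Finsupp.supported F F (T : Set ι)).map (Finsupp.linearCombination F c)) :
    Module.finrank F V + b.card ≤ T.card := by
  have e := Finsupp.supportedEquivFinsupp (M := F) (R := F) (T : Set ι)
  have : Module.Finite F (Finsupp.supported F F (T : Set ι)) := Module.Finite.equiv e.symm
  set f := (Finsupp.linearCombination F c).domRestrict (Finsupp.supported F F (T : Set ι))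
  have hrank := LinearMap.finrank_range_add_finrank_ker
    (V := Finsupp.supported F F (T : Set ι)) (V₂ := V) f
  have hcard : Module.finrank F (Finsupp.supported F F (T : Set ι)) = T.card := by
    rw [e.finrank_eq]
    simp
  have hrange : LinearMap.range f = ⊤ := by
    rw [LinearMap.range_domRestrict]
    exact top_le_iff.1 hspan
  let v : b → LinearMap.ker f := fun w =>
    ⟨⟨w, by simpa [Finsupp.mem_supported] using hT w w.2⟩, hker w w.2⟩
  have hv : LinearIndependent F v :=
    LinearIndependent.of_comp
      ((Finsupp.supported F F (T : Set ι)).subtype ∘ₗ (LinearMap.ker f).subtype) hb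
  have : Module.Finite F (LinearMap.ker f) :=
    FiniteDimensional.finiteDimensional_submodule (V := Finsupp.supported F F (T : Set ι)) _
  have hle := hv.fintype_card_le_finrank
  rw [hrange, finrank_top, hcard] at hrank
  rw [Fintype.card_coe] at hle
  omega

theorem IsPIRCode.exists_redundancy [Fintype ι] {C : (Fin k → F) →ₗ[F] (ι → F)} {r : ℕ}
    (h : IsPIRCode r 2 C) :
    ∃ d : ℕ, k + d ≤ Fintype.card ι ∧ k + d ≤ 2 * r * d := by
  classical
  choose w hw hcard l hl hproj using h.exists_relation
  obtain ⟨b', hb', hspan, hli⟩ := exists_linearIndependent F (Set.range w)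
  obtain ⟨b, rfl⟩ := ((Set.finite_range w).subset hb').exists_finset_coe
  have hb : ∀ u ∈ b, ∃ i, w i = u := fun u hu => hb' hu
  set c := codeFunctional C
  have hker : ∀ u ∈ b, Finsupp.linearCombination F c u = 0 := by
    intro u hu
    obtain ⟨i, rfl⟩ := hb u hu
    exact hw i
  have key : ∀ T : Finset ι, (∀ u ∈ b, u.support ⊆ T) → k + b.card ≤ T.card := by
    intro T hT
    have hsupp : ∀ i, (w i).support ⊆ T := by
      intro i
      have hle : Submodule.span F (b : Set (ι →₀ F)) ≤ Finsupp.supported F F (T : Set ι) :=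
        Submodule.span_le.2 fun u hu => by simpa [Finsupp.mem_supported] using hT u hu
      have := hle (hspan ▸ Submodule.subset_span (Set.mem_range_self i))
      simpa [Finsupp.mem_supported] using this
    have hfin := finrank_add_card_le_card_of_relations c T b hli hker hT fun φ _ => by
      have hφ : φ = ∑ i, φ (Pi.single i 1) • (LinearMap.proj i : Module.Dual F (Fin k → F)) := by
        refine LinearMap.pi_ext' fun j => LinearMap.ext_ring ?_
        simp [Pi.single_apply]
      rw [hφ]
      refine Submodule.sum_mem _ fun i _ => Submodule.smul_mem _ _ ⟨l i, ?_, hproj i⟩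
      simpa [Finsupp.mem_supported] using (hl i).trans (hsupp i)
    rwa [Subspace.dual_finrank_eq, Module.finrank_fin_fun] at hfin
  refine ⟨b.card, by simpa using key Finset.univ fun _ _ => Finset.subset_univ _, ?_⟩
  calc k + b.card ≤ (b.biUnion Finsupp.support).card :=
        key _ fun u hu => Finset.subset_biUnion_of_mem Finsupp.support hu
    _ ≤ b.card * (2 * r) := Finset.card_biUnion_le_card_mul _ _ _ fun u hu => by
        obtain ⟨i, rfl⟩ := hb u hu
        exact hcard i
    _ = 2 * r * b.card := mul_comm _ _

end LowerBound

section UpperBound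

variable {F : Type} [Field F] {k m : ℕ}

/-- The systematic encoding that adjoins one parity coordinate for every fibre of `g`. -/
def parityCode (F : Type) [Field F] (g : Fin k → Fin m) :
    (Fin k → F) →ₗ[F] (Fin m ⊕ Fin k → F) where
  toFun x := Sum.elim (fun a => ∑ j with g j = a, x j) x
  map_add' x y := by
    ext (a | j) <;> simp [Finset.sum_add_distrib]
  map_smul' a x := by
    ext (a | j) <;> simp [Finset.mul_sum]

theorem parityCode_isBatchCode (g : Fin k → Fin m) {r : ℕ} (hr : 1 ≤ r)
    (hg : ∀ a, (Finset.univ.filter fun j => g j = a).card ≤ r) :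
    IsBatchCode r 2 (parityCode F g) := by
  classical
  have hsingle : ∀ i, IsRecoverySet (parityCode F g) i {Sum.inr i} := fun i x x' h =>
    h (Sum.inr i) (Finset.mem_singleton_self _)
  refine ⟨fun x x' h => funext fun i => hsingle i x x' fun j _ => congrFun h j, fun q => ?_⟩
  by_cases hq : q 0 = q 1
  · set i := q 1
    set G := Finset.univ.filter fun j => g j = g i
    have hi : i ∈ G := by simp [G]
    let P : Finset (Fin m ⊕ Fin k) := insert (Sum.inl (g i)) ((G.erase i).map .inr)
    have hPcard : P.card ≤ r := by
      have h₁ := Finset.card_insert_le (Sum.inl (g i) : Fin m ⊕ Fin k) ((G.erase i).map .inr)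
      rw [Finset.card_map, Finset.card_erase_of_mem hi] at h₁
      have h₂ : G.card ≤ r := hg (g i)
      change P.card ≤ _ at h₁
      omega
    have hPdisj : Disjoint {Sum.inr i} P := by simp [P]
    have hPrec : IsRecoverySet (parityCode F g) i P := by
      intro x x' h
      have hsum : ∑ j ∈ G, x j = ∑ j ∈ G, x' j := h (Sum.inl (g i)) (by simp [P])
      have herase : ∑ j ∈ G.erase i, x j = ∑ j ∈ G.erase i, x' j :=
        Finset.sum_congr rfl fun j hj =>
          h (Sum.inr j) (Finset.mem_insert_of_mem (Finset.mem_map_of_mem _ hj))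
      rw [← Finset.add_sum_erase G x hi, ← Finset.add_sum_erase G x' hi, herase] at hsum
      exact add_right_cancel hsum
    refine ⟨![{Sum.inr i}, P], ?_, ?_, ?_⟩
    · simp only [Fin.forall_fin_two]
      exact ⟨⟨fun h => (h rfl).elim, fun _ => hPdisj⟩,
        ⟨fun _ => hPdisj.symm, fun h => (h rfl).elim⟩⟩
    · simpa [Fin.forall_fin_two] using ⟨hr, hPcard⟩
    · rw [Fin.forall_fin_two]
      exact ⟨hq ▸ hsingle (q 0), hPrec⟩
  · refine ⟨fun a => {Sum.inr (q a)}, ?_, fun _ => by simpa using hr, fun a => hsingle (q a)⟩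
    simp [Fin.forall_fin_two, hq, Ne.symm hq]

theorem IsBatchCode.reindex {ι κ : Type} {r t : ℕ} {C : (Fin k → F) →ₗ[F] (ι → F)}
    (h : IsBatchCode r t C) (e : κ ≃ ι) :
    IsBatchCode r t (LinearMap.funLeft F F e ∘ₗ C) := by
  refine ⟨(LinearMap.funLeft_injective_of_surjective F F e e.surjective).comp h.1, fun q => ?_⟩
  obtain ⟨R, hdisj, hcard, hrec⟩ := h.2 q
  refine ⟨fun a => (R a).map e.symm.toEmbedding,
    fun a b hab => (Finset.disjoint_map _).2 (hdisj a b hab),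
    fun a => by simpa using hcard a, fun a x x' hx => hrec a x x' fun j hj => ?_⟩
  simpa [LinearMap.funLeft_apply] using
    hx (e.symm j) (Finset.mem_map_of_mem e.symm.toEmbedding hj)

theorem exists_isBatchCode_two (k : ℕ) {r : ℕ} (hr : 1 ≤ r) :
    ∃ C : (Fin k → F) →ₗ[F] (Fin ((k + r - 1) / r + k) → F), IsBatchCode r 2 C := by
  have hlt : ∀ j : Fin k, (j : ℕ) / r < (k + r - 1) / r := fun j => by
    rw [← Nat.succ_le_iff, Nat.le_div_iff_mul_le hr, Nat.succ_mul]
    have := Nat.div_mul_le_self j r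
    omega
  refine ⟨_, (parityCode_isBatchCode (fun j => ⟨j / r, hlt j⟩) hr fun a => ?_).reindex
    finSumFinEquiv.symm⟩
  have := Finset.card_le_card_of_injOn (s := Finset.univ.filter fun j : Fin k =>
    (⟨j / r, hlt j⟩ : Fin ((k + r - 1) / r)) = a) (t := Finset.range r) (fun j => (j : ℕ) % r)
    (fun j _ => by simpa using Nat.mod_lt _ hr) fun i hi j hj hij => by
      simp only [Finset.coe_filter, Finset.mem_univ, true_and, Set.mem_ofPred_eq] at hi hj
      have hdiv : (i : ℕ) / r = j / r := congrArg Fin.val (hi.trans hj.symm)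
      have hmod : (i : ℕ) % r = j % r := hij
      rw [Fin.ext_iff, ← Nat.div_add_mod i r, ← Nat.div_add_mod j r, hdiv, hmod]
  simpa using this

end UpperBound

theorem IsBatchCode.isPIRCode {F : Type} [Field F] {k r t : ℕ} {ι : Type}
    {C : (Fin k → F) →ₗ[F] (ι → F)} (h : IsBatchCode r t C) : IsPIRCode r t C :=
  ⟨h.1, fun i => h.2 fun _ => i⟩

/-- Bounds on the optimal length of (not necessarily systematic) linear binary batch and
PIR codes with `t = 2` and `r ≥ 2`:
`⌈k/r⌉ + k ≥ B_n(k,r,2) ≥ P_n(k,r,2) ≥ ⌈k/(2r−1)⌉ + k`. -/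
theorem optimal_length_nonsystematic_t_two (k r : ℕ) (hk : 1 ≤ k) (hr : 2 ≤ r) :
    sInf {n : ℕ | ∃ C : (Fin k → ZMod 2) →ₗ[ZMod 2] (Fin n → ZMod 2),
        IsBatchCode r 2 C} ≤ (k + r - 1) / r + k ∧
    sInf {n : ℕ | ∃ C : (Fin k → ZMod 2) →ₗ[ZMod 2] (Fin n → ZMod 2),
        IsPIRCode r 2 C} ≤
      sInf {n : ℕ | ∃ C : (Fin k → ZMod 2) →ₗ[ZMod 2] (Fin n → ZMod 2),
        IsBatchCode r 2 C} ∧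
    (k + (2 * r - 1) - 1) / (2 * r - 1) + k ≤
      sInf {n : ℕ | ∃ C : (Fin k → ZMod 2) →ₗ[ZMod 2] (Fin n → ZMod 2),
        IsPIRCode r 2 C} := by
  obtain ⟨C₀, hC₀⟩ := exists_isBatchCode_two (F := ZMod 2) k (one_le_two.trans hr)
  refine ⟨Nat.sInf_le ⟨C₀, hC₀⟩, ?_, ?_⟩
  · obtain ⟨C, hC⟩ := Nat.sInf_mem (s := {n : ℕ |
      ∃ C : (Fin k → ZMod 2) →ₗ[ZMod 2] (Fin n → ZMod 2), IsBatchCode r 2 C}) ⟨_, C₀, hC₀⟩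
    exact Nat.sInf_le ⟨C, hC.isPIRCode⟩
  · refine le_csInf ⟨_, C₀, hC₀.isPIRCode⟩ ?_
    rintro n ⟨C, hC⟩
    obtain ⟨d, hn, hd⟩ := hC.exists_redundancy
    rw [Fintype.card_fin] at hn
    have hceil : (k + (2 * r - 1) - 1) / (2 * r - 1) ≤ d := by
      have hk' : k ≤ (2 * r - 1) * d := by
        rw [Nat.sub_mul]
        omega
      rw [← Nat.lt_succ_iff, Nat.div_lt_iff_lt_mul (by omega), Nat.succ_mul d, mul_comm d]
      omega
    omega
end

section
/- Let r ≥ 3 and t = 3. Then k + 1 + ⌈(2k−1)/(2r−1)⌉ ≤ B(k,r,3), and moreover: if r | k then B(k,r,3) ≤ (r+1)·(k/r) + ζ where ζ = max{k/r, r}; if r ∤ k then B(k,r,3) ≤ (r+1)·⌊k/r⌋ + 2s + 1 + ⌈(k − s − τ − η·s)/γ⌉, where s = k mod r, τ = min{r−s, ⌊k/r⌋}, η = min{r−1, ⌊k/r⌋}, and γ = min{r, ⌊k/r⌋}. -/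
open Finset Submodule in
/-- A spanning-set version of the availability bound: if the family `v` still spans after deleting
any two vectors, and any non-spanning subfamily misses some `v i` having two disjoint repair sets
of size at most `r`, then the family is long. -/
theorem card_lower_bound_of_two_repair_sets {K V ι : Type*} [Field K] [AddCommGroup V] [Module K V]
    [FiniteDimensional K V] [Fintype ι] [DecidableEq ι] (v : ι → V) (r : ℕ) (hr : 1 ≤ r)
    (hV : 1 ≤ Module.finrank K V)
    (hdel : ∀ U : Finset ι, #U ≤ 2 → span K (v '' (Uᶜ : Finset ι)) = ⊤)
    (hrep : ∀ S : Finset ι, span K (v '' S) ≠ ⊤ → ∃ (i : ι) (A B : Finset ι),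
      v i ∉ span K (v '' S) ∧ i ∉ A ∧ i ∉ B ∧ Disjoint A B ∧ #A ≤ r ∧ #B ≤ r ∧
      v i ∈ span K (v '' A) ∧ v i ∈ span K (v '' B)) :
    2 * Module.finrank K V - 1 + (2 * r - 1) + (2 * r - 1) * Module.finrank K V ≤
      (2 * r - 1) * Fintype.card ι := by
  classical
  set k := Module.finrank K V with hkdef
  set rk : Finset ι → ℕ := fun S => Module.finrank K (span K (v '' S)) with hrk
  have rk_top {S : Finset ι} (h : span K (v '' (S : Set ι)) = ⊤) : rk S = k := by
    change Module.finrank K (span K (v '' (S : Set ι))) = k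
    rw [h, finrank_top]
  have rk_union (S T : Finset ι) : rk (S ∪ T) ≤ rk S + #T := by
    have h1 : span K (v '' ((S ∪ T : Finset ι) : Set ι)) =
        span K (v '' S) ⊔ span K (v '' T) := by
      rw [coe_union, Set.image_union, span_union]
    have h2 : Module.finrank K (span K (v '' (T : Set ι))) ≤ #T := by
      have := finrank_span_finset_le_card (R := K) (T.image v)
      rw [coe_image] at this
      exact this.trans card_image_le
    have h3 := Submodule.finrank_add_le_finrank_add_finrank (span K (v '' (S : Set ι)))
      (span K (v '' (T : Set ι)))
    rw [← h1] at h3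
    simp only [hrk]
    omega
  have rk_mono {S T : Finset ι} (h : v '' (S : Set ι) ⊆ span K (v '' (T : Set ι))) :
      rk S ≤ rk T := Submodule.finrank_mono (span_le.2 h)
  have key (T : Finset ι) (hT : rk T < k) : k + 2 + #T ≤ Fintype.card ι + rk T := by
    have hc := card_compl_add_card T
    obtain ⟨U, hU, hU2⟩ : ∃ U ⊆ Tᶜ, #U = min 2 #Tᶜ :=
      exists_subset_card_eq (min_le_right _ _)
    have h1 : rk Uᶜ = k := rk_top (hdel U (by omega))
    have h2 : Uᶜ = T ∪ (Tᶜ \ U) := by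
      ext x
      have := @hU x
      simp only [mem_compl, mem_union, mem_sdiff] at this ⊢
      tauto
    have h3 := rk_union T (Tᶜ \ U)
    rw [← h2, h1, card_sdiff_of_subset hU] at h3
    omega
  obtain ⟨S, ⟨hS1, hS2⟩, hmax⟩ : ∃ S : Finset ι,
      (rk S < k ∧ 2 * rk S + (2 * r - 1) * rk S ≤ (2 * r - 1) * #S) ∧
      ∀ T : Finset ι, (rk T < k ∧ 2 * rk T + (2 * r - 1) * rk T ≤ (2 * r - 1) * #T) →
        rk T ≤ rk S := by
    obtain ⟨S, hS, hm⟩ := exists_max_image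
      (univ.filter fun S : Finset ι =>
        rk S < k ∧ 2 * rk S + (2 * r - 1) * rk S ≤ (2 * r - 1) * #S) rk
      ⟨∅, by
        have : rk ∅ = 0 := by simp [hrk]
        simp only [mem_filter, mem_univ, true_and, this]
        simp
        omega⟩
    exact ⟨S, (mem_filter.1 hS).2, fun T hT => hm T (mem_filter.2 ⟨mem_univ _, hT⟩)⟩
  obtain ⟨i, A, B, hi, hiA, hiB, hAB, hA, hB, hsA, hsB⟩ := hrep S (by
    intro h
    have := rk_top h
    omega)
  have hiS : i ∉ S := fun h => hi (subset_span ⟨i, h, rfl⟩)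
  have hAS : #(A \ S) ≤ r := (card_le_card sdiff_subset).trans hA
  have hBS : #(B \ S) ≤ r := (card_le_card sdiff_subset).trans hB
  -- one repair set
  have hc1 : #(insert i (S ∪ (A \ S))) = #S + #(A \ S) + 1 := by
    rw [card_insert_of_notMem (by simp [hiS, hiA]), card_union_of_disjoint disjoint_sdiff]
  have hr1 : rk (insert i (S ∪ (A \ S))) ≤ rk S + #(A \ S) := by
    refine le_trans (rk_mono ?_) (rk_union S (A \ S))
    rintro _ ⟨x, hx, rfl⟩
    rcases mem_insert.1 (mem_coe.1 hx) with rfl | hx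
    · refine span_mono (Set.image_mono ?_) hsA
      rw [union_sdiff_self_eq_union]
      exact coe_subset.2 subset_union_right
    · exact subset_span ⟨x, hx, rfl⟩
  -- both repair sets
  obtain ⟨j, hjB, hjS, hj⟩ : ∃ j ∈ B, j ∉ S ∧
      v j ∈ span K (insert (v i) (v '' ((S ∪ B.erase j : Finset ι) : Set ι))) := by
    by_contra! hcon
    apply hi
    obtain ⟨c, hc⟩ := (mem_span_image_finset_iff_exists_fun' K).1 hsB
    have hz : ∀ j ∈ B, j ∉ S → c j = 0 := by
      intro j hj hjS
      by_contra h0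
      apply hcon j hj hjS
      have : v j = (c j)⁻¹ • (v i - ∑ x ∈ B.erase j, c x • v x) := by
        rw [← hc, ← add_sum_erase B _ hj, add_sub_cancel_right, smul_smul, inv_mul_cancel₀ h0,
          one_smul]
      rw [this]
      refine smul_mem _ _ (sub_mem (subset_span (Set.mem_insert _ _)) (sum_mem fun x hx =>
        smul_mem _ _ (subset_span (Set.mem_insert_of_mem _ ⟨x, ?_, rfl⟩))))
      exact mem_coe.2 (mem_union_right _ hx)
    rw [← hc]
    refine sum_mem fun x hx => ?_
    by_cases hxS : x ∈ S
    · exact smul_mem _ _ (subset_span ⟨x, hxS, rfl⟩)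
    · rw [hz x hx hxS, zero_smul]
      exact zero_mem _
  have hdisj : Disjoint (A \ S) (B \ S) := disjoint_of_subset_left sdiff_subset
    (disjoint_of_subset_right sdiff_subset hAB)
  have hdisj2 : Disjoint S ((A \ S) ∪ (B \ S)) :=
    disjoint_union_right.2 ⟨disjoint_sdiff, disjoint_sdiff⟩
  have hc2 : #(insert i (S ∪ ((A \ S) ∪ (B \ S)))) = #S + #(A \ S) + #(B \ S) + 1 := by
    rw [card_insert_of_notMem (by simp [hiS, hiA, hiB]), card_union_of_disjoint hdisj2,
      card_union_of_disjoint hdisj]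
    omega
  have hjBS : j ∈ B \ S := mem_sdiff.2 ⟨hjB, hjS⟩
  have hBpos : 0 < #(B \ S) := card_pos.2 ⟨j, hjBS⟩
  have hr2 : rk (insert i (S ∪ ((A \ S) ∪ (B \ S)))) ≤
      rk S + #(A \ S) + (#(B \ S) - 1) := by
    set T := S ∪ ((A \ S) ∪ (B \ S).erase j) with hT
    have hTc : rk T ≤ rk S + #(A \ S) + (#(B \ S) - 1) := by
      have h1 := rk_union S ((A \ S) ∪ (B \ S).erase j)
      have h2 := card_union_le (A \ S) ((B \ S).erase j)
      rw [card_erase_of_mem hjBS] at h2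
      rw [hT]
      omega
    refine le_trans (rk_mono ?_) hTc
    have hiT : v i ∈ span K (v '' (T : Set ι)) := by
      refine span_mono (Set.image_mono (coe_subset.2 ?_)) hsA
      intro x hx
      by_cases hxS : x ∈ S <;> simp [hT, hx, hxS]
    have hjT : v j ∈ span K (v '' (T : Set ι)) := by
      refine span_le.2 (Set.insert_subset hiT ?_) hj
      rintro _ ⟨x, hx, rfl⟩
      refine subset_span ⟨x, ?_, rfl⟩
      simp only [hT, mem_coe, mem_union, mem_erase, mem_sdiff] at hx ⊢
      tauto
    rintro _ ⟨x, hx, rfl⟩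
    rcases mem_insert.1 (mem_coe.1 hx) with rfl | hx
    · exact hiT
    · by_cases hxj : x = j
      · rw [hxj]
        exact hjT
      · refine subset_span ⟨x, ?_, rfl⟩
        simp only [hT, mem_coe, mem_union, mem_erase, mem_sdiff] at hx ⊢
        tauto
  have hr2' : rk S < rk (insert i (S ∪ ((A \ S) ∪ (B \ S)))) := by
    refine Submodule.finrank_lt_finrank_of_lt (lt_of_le_of_ne (span_mono (Set.image_mono ?_)) ?_)
    · exact coe_subset.2 (subset_union_left.trans (subset_insert _ _))
    · intro h
      apply hi
      rw [h]
      exact subset_span ⟨i, mem_insert_self _ _, rfl⟩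
  obtain ⟨c, hc⟩ : ∃ c, c = 2 * r - 1 := ⟨_, rfl⟩
  rw [← hc] at hS2 hmax ⊢
  have hfull : k ≤ rk S + c := by
    by_contra! hlt
    have := hmax (insert i (S ∪ ((A \ S) ∪ (B \ S)))) ⟨by omega, by
      rw [hc2]
      generalize rk (insert i (S ∪ ((A \ S) ∪ (B \ S)))) = ρ at *
      have h1 : ρ + 2 ≤ rk S + #(A \ S) + #(B \ S) + 1 := by omega
      have h2 : ρ ≤ rk S + c := by omega
      have h3 : c * (ρ + 2) ≤ c * (rk S + #(A \ S) + #(B \ S) + 1) := Nat.mul_le_mul_left c h1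
      nlinarith⟩
    omega
  by_cases hcase : rk (insert i (S ∪ (A \ S))) < k
  · have h1 := key _ hcase
    rw [hc1] at h1
    have h2 : k + 3 + #S ≤ Fintype.card ι + rk S := by omega
    have h3 := Nat.mul_le_mul_left c h2
    have h4 : 2 * k - 1 ≤ 2 * rk S + 2 * c := by omega
    nlinarith
  · have h1 := key _ hS1
    have h3 := Nat.mul_le_mul_left c h1
    have h4 : 2 * k - 1 ≤ 2 * rk S + c := by omega
    nlinarith

open Submodule in
theorem IsRecoverySet.proj_mem_span {F : Type} [Field F] {k : ℕ} {ι : Type}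
    {C : (Fin k → F) →ₗ[F] (ι → F)} {i : Fin k} {R : Finset ι} (h : IsRecoverySet C i R) :
    (LinearMap.proj i : (Fin k → F) →ₗ[F] F) ∈
      span F ((fun j => (LinearMap.proj j : (ι → F) →ₗ[F] F) ∘ₗ C) '' (R : Set ι)) := by
  rw [Set.image_eq_range]
  apply mem_span_of_iInf_ker_le_ker
  intro x hx
  simp only [mem_iInf, LinearMap.mem_ker, Subtype.forall] at hx
  have := h x 0 (fun j hj => by simpa using hx j hj)
  simpa using this

open Finset Submodule in
theorem IsBatchCode.length_lower_bound {k r n : ℕ} (hk : 1 ≤ k) (hr : 1 ≤ r)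
    {C : (Fin k → ZMod 2) →ₗ[ZMod 2] (Fin n → ZMod 2)} (hs : IsSystematic C)
    (hC : IsBatchCode r 3 C) :
    2 * k - 1 + (2 * r - 1) + (2 * r - 1) * k ≤ (2 * r - 1) * n := by
  set v : Fin n → Module.Dual (ZMod 2) (Fin k → ZMod 2) :=
    fun j => LinearMap.proj j ∘ₗ C with hv
  have hfin : Module.finrank (ZMod 2) (Module.Dual (ZMod 2) (Fin k → ZMod 2)) = k := by
    rw [Subspace.dual_finrank_eq]
    simp
  have htop (W : Submodule (ZMod 2) (Module.Dual (ZMod 2) (Fin k → ZMod 2)))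
      (h : ∀ i, (LinearMap.proj i : (Fin k → ZMod 2) →ₗ[ZMod 2] ZMod 2) ∈ W) : W = ⊤ := by
    refine eq_top_iff.2 fun f _ => ?_
    have : f = ∑ i, f (Pi.single i 1) • LinearMap.proj i := by
      refine LinearMap.pi_ext' fun i => LinearMap.ext_ring ?_
      simp [Pi.single_apply]
    rw [this]
    exact sum_mem fun i _ => smul_mem _ _ (h i)
  have := card_lower_bound_of_two_repair_sets v r hr (by rw [hfin]; exact hk) ?_ ?_
  · rwa [hfin, Fintype.card_fin] at this
  · intro U hU
    refine htop _ fun i => ?_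
    obtain ⟨R, hd, -, hR⟩ := hC.2 fun _ => i
    obtain ⟨l, hl⟩ : ∃ l, Disjoint (R l) U := by
      by_contra! hcon
      choose f hf using fun l => not_disjoint_iff.1 (hcon l)
      have hinj : Function.Injective f := by
        intro a b hab
        by_contra hne
        exact disjoint_left.1 (hd a b hne) (hf a).1 (hab ▸ (hf b).1)
      have := card_le_card_of_injOn (s := univ) f (fun l _ => (hf l).2) hinj.injOn
      simp at this
      omega
    refine span_mono (Set.image_mono ?_) (hR l).proj_mem_span
    exact coe_subset.2 (subset_compl_iff_disjoint_right.2 hl)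
  · intro S hS
    obtain ⟨i, hi⟩ : ∃ i, (LinearMap.proj i : (Fin k → ZMod 2) →ₗ[ZMod 2] ZMod 2) ∉
        span (ZMod 2) (v '' S) := by
      by_contra! h
      exact hS (htop _ h)
    obtain ⟨R, hd, hcard, hR⟩ := hC.2 fun _ => i
    obtain ⟨hin, -⟩ := hs 0 i
    have hvi : v ⟨i, hin⟩ = LinearMap.proj i := by
      refine LinearMap.ext fun x => ?_
      obtain ⟨_, hx⟩ := hs x i
      exact hx
    obtain ⟨a, b, hab, ha, hb⟩ : ∃ a b, a ≠ b ∧ (⟨i, hin⟩ : Fin n) ∉ R a ∧ (⟨i, hin⟩ : Fin n) ∉ R b := by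
      have h01 : (⟨i, hin⟩ : Fin n) ∈ R 0 → (⟨i, hin⟩ : Fin n) ∉ R 1 := fun h =>
        disjoint_left.1 (hd 0 1 (by decide)) h
      have h02 : (⟨i, hin⟩ : Fin n) ∈ R 0 → (⟨i, hin⟩ : Fin n) ∉ R 2 := fun h =>
        disjoint_left.1 (hd 0 2 (by decide)) h
      have h12 : (⟨i, hin⟩ : Fin n) ∈ R 1 → (⟨i, hin⟩ : Fin n) ∉ R 2 := fun h =>
        disjoint_left.1 (hd 1 2 (by decide)) h
      by_cases h0 : (⟨i, hin⟩ : Fin n) ∈ R 0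
      · exact ⟨1, 2, by decide, h01 h0, h02 h0⟩
      · by_cases h1 : (⟨i, hin⟩ : Fin n) ∈ R 1
        · exact ⟨0, 2, by decide, h0, h12 h1⟩
        · exact ⟨0, 1, by decide, h0, h1⟩
    exact ⟨⟨i, hin⟩, R a, R b, hvi ▸ hi, ha, hb, hd a b hab, hcard a, hcard b,
      hvi ▸ (hR a).proj_mem_span, hvi ▸ (hR b).proj_mem_span⟩

open Finset in
/-- If every information symbol lies in two parity checks of size at most `r` meeting only in that
symbol, then appending all the parity checks gives a systematic batch code for `t = 3`. -/
theorem exists_batchCode_of_parityChecks {k ρ r : ℕ} (hr : 1 ≤ r) (B : ℕ → Finset ℕ)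
    (hB : ∀ p < ρ, #(B p) ≤ r)
    (hcov : ∀ i < k, ∃ p < ρ, ∃ q < ρ, p ≠ q ∧ B p ∩ B q = {i}) :
    ∃ C : (Fin k → ZMod 2) →ₗ[ZMod 2] (Fin (k + ρ) → ZMod 2),
      IsSystematic C ∧ IsBatchCode r 3 C := by
  set G : Fin ρ → Finset (Fin k) := fun p => univ.filter fun i => (i : ℕ) ∈ B p with hG
  have hGcard (p) : #(G p) ≤ r := by
    refine le_trans ?_ (hB p p.2)
    exact card_le_card_of_injOn Fin.val (fun i hi => (mem_filter.1 hi).2) Fin.val_injective.injOn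
  set C : (Fin k → ZMod 2) →ₗ[ZMod 2] (Fin (k + ρ) → ZMod 2) :=
    LinearMap.pi (Fin.addCases (fun i => LinearMap.proj i)
      (fun p => ∑ i ∈ G p, LinearMap.proj i)) with hCdef
  have hCl (x i) : C x (Fin.castAdd ρ i) = x i := by simp [hCdef]
  have hCr (x p) : C x (Fin.natAdd k p) = ∑ i ∈ G p, x i := by simp [hCdef]
  have hinj : Function.Injective C := by
    intro x y h
    funext i
    rw [← hCl x, ← hCl y, h]
  refine ⟨C, fun x i => ⟨by omega, hCl x i⟩, hinj, ?_⟩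
  set A : Fin k → Fin ρ → Finset (Fin (k + ρ)) := fun i p =>
    insert (Fin.natAdd k p) (((G p).erase i).image (Fin.castAdd ρ)) with hA
  have hself (i) : IsRecoverySet C i {Fin.castAdd ρ i} := by
    intro x y h
    simpa [hCl] using h _ (mem_singleton_self _)
  have hArec {i p} (hi : i ∈ G p) : IsRecoverySet C i (A i p) := by
    intro x y h
    have h1 := h _ (mem_insert_self _ _)
    rw [hCr, hCr, ← add_sum_erase _ _ hi, ← add_sum_erase _ _ hi] at h1
    have h2 : ∑ j ∈ (G p).erase i, x j = ∑ j ∈ (G p).erase i, y j := by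
      refine sum_congr rfl fun j hj => ?_
      have := h _ (mem_insert_of_mem (mem_image_of_mem _ hj))
      rwa [hCl, hCl] at this
    rw [h2] at h1
    exact add_right_cancel h1
  have hAcard {i p} (hi : i ∈ G p) : #(A i p) ≤ r := by
    have h1 := card_insert_le (Fin.natAdd k p) (((G p).erase i).image (Fin.castAdd ρ))
    have h2 := card_image_le (s := (G p).erase i) (f := Fin.castAdd ρ)
    rw [card_erase_of_mem hi] at h2
    have h3 := card_pos.2 ⟨i, hi⟩
    have h4 := hGcard p
    simp only [hA]
    omega
  have hne (i : Fin k) (p : Fin ρ) : Fin.castAdd ρ i ≠ Fin.natAdd k p := by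
    intro h
    have := congrArg Fin.val h
    simp at this
    omega
  have hmemA {i p j} : Fin.castAdd ρ j ∈ A i p ↔ j ≠ i ∧ j ∈ G p := by
    simp [hA, hne]
  have hcov' (i) : ∃ p q : Fin ρ, i ∈ G p ∧ i ∈ G q ∧ p ≠ q ∧ ∀ j, j ∈ G p → j ∈ G q → j = i := by
    obtain ⟨p, hp, q, hq, hpq, h⟩ := hcov i i.2
    have hi : (i : ℕ) ∈ B p ∩ B q := by simp [h]
    refine ⟨⟨p, hp⟩, ⟨q, hq⟩, by simpa [hG] using (mem_inter.1 hi).1,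
      by simpa [hG] using (mem_inter.1 hi).2, by simpa using hpq, fun j hj hj' => ?_⟩
    have : (j : ℕ) ∈ B p ∩ B q :=
      mem_inter.2 ⟨by simpa [hG] using hj, by simpa [hG] using hj'⟩
    rw [h] at this
    exact Fin.ext (mem_singleton.1 this)
  have hAdisj {i p q} (hpq : p ≠ q) (h : ∀ j, j ∈ G p → j ∈ G q → j = i) :
      Disjoint (A i p) (A i q) := by
    rw [disjoint_left]
    intro x
    refine Fin.addCases (fun j => ?_) (fun j => ?_) x
    · rw [hmemA, hmemA]
      exact fun h1 h2 => h1.1 (h j h1.2 h2.2)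
    · intro h1 h2
      have h3 : j = p := by simpa [hA, hne] using h1
      have h4 : j = q := by simpa [hA, hne] using h2
      exact hpq (h3.symm.trans h4)
  have hsd {i j} (h : i ≠ j) :
      Disjoint ({Fin.castAdd ρ i} : Finset (Fin (k + ρ))) {Fin.castAdd ρ j} := by
    simpa using h
  have hpair (a c) : ∃ X Y Z : Finset (Fin (k + ρ)), Disjoint X Y ∧ Disjoint X Z ∧ Disjoint Y Z ∧
      #X ≤ r ∧ #Y ≤ r ∧ #Z ≤ r ∧
      IsRecoverySet C a X ∧ IsRecoverySet C a Y ∧ IsRecoverySet C c Z := by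
    obtain ⟨p, q, hp, hq, hpq, h⟩ := hcov' a
    have hdis (p) : Disjoint {Fin.castAdd ρ a} (A a p) := by
      rw [disjoint_singleton_left, hmemA]
      simp
    by_cases hca : c = a
    · subst hca
      exact ⟨_, _, _, hdis p, hdis q, hAdisj hpq h, by simpa using hr, hAcard hp, hAcard hq,
        hself c, hArec hp, hArec hq⟩
    · obtain ⟨u, hu, hcu⟩ : ∃ u, a ∈ G u ∧ c ∉ G u := by
        by_cases hcp : c ∈ G p
        · exact ⟨q, hq, fun hcq => hca (h c hcp hcq)⟩
        · exact ⟨p, hp, hcp⟩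
      refine ⟨_, _, _, hdis u, hsd (Ne.symm hca), ?_, by simpa using hr, hAcard hu,
        by simpa using hr, hself a, hArec hu, hself c⟩
      rw [disjoint_singleton_right, hmemA]
      exact fun h => hcu h.2
  have htriple (a b c) : ∃ X Y Z : Finset (Fin (k + ρ)),
      Disjoint X Y ∧ Disjoint X Z ∧ Disjoint Y Z ∧ #X ≤ r ∧ #Y ≤ r ∧ #Z ≤ r ∧
      IsRecoverySet C a X ∧ IsRecoverySet C b Y ∧ IsRecoverySet C c Z := by
    by_cases hab : a = b
    · subst hab
      exact hpair a c
    by_cases hac : a = c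
    · subst hac
      obtain ⟨X, Y, Z, h1, h2, h3, h4, h5, h6, h7, h8, h9⟩ := hpair a b
      exact ⟨X, Z, Y, h2, h1, h3.symm, h4, h6, h5, h7, h9, h8⟩
    by_cases hbc : b = c
    · subst hbc
      obtain ⟨X, Y, Z, h1, h2, h3, h4, h5, h6, h7, h8, h9⟩ := hpair b a
      exact ⟨Z, X, Y, h2.symm, h3.symm, h1, h6, h4, h5, h9, h7, h8⟩
    exact ⟨_, _, _, hsd hab, hsd hac, hsd hbc, by simpa using hr, by simpa using hr,
      by simpa using hr, hself a, hself b, hself c⟩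
  intro q
  obtain ⟨X, Y, Z, h1, h2, h3, h4, h5, h6, h7, h8, h9⟩ := htriple (q 0) (q 1) (q 2)
  refine ⟨![X, Y, Z], ?_, ?_, ?_⟩
  · intro a b hab
    fin_cases a <;> fin_cases b
    exacts [absurd rfl hab, h1, h2, h1.symm, absurd rfl hab, h3, h2.symm, h3.symm, absurd rfl hab]
  · intro l
    fin_cases l
    exacts [h4, h5, h6]
  · intro l
    fin_cases l
    exacts [h7, h8, h9]

open Finset in
/-- The `r * m` symbols are arranged cyclically in `m` columns of height `r`. They are cut into
consecutive blocks of lengths `c g ≤ m`, which therefore meet each column at most once, and the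
remaining `s` symbols are adjoined to the blocks as prescribed by `E`. -/
theorem exists_batchCode_of_blocks {r m s G : ℕ} (hr : 1 ≤ r) (c : ℕ → ℕ)
    (hcm : ∀ g < G, c g ≤ m) (hsum : r * m ≤ ∑ g ∈ range G, c g) (E : ℕ → Finset ℕ)
    (hE : ∀ g < G, c g + #(E g) ≤ r)
    (hcov : ∀ j < s, ∃ g < G, ∃ g' < G, g ≠ g' ∧ E g ∩ E g' = {j}) :
    ∃ C : (Fin (r * m + s) → ZMod 2) →ₗ[ZMod 2] (Fin (r * m + s + (m + G)) → ZMod 2),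
      IsSystematic C ∧ IsBatchCode r 3 C := by
  set lo : ℕ → ℕ := fun g => ∑ i ∈ range g, c i with hlo
  have lo_succ (g) : lo (g + 1) = lo g + c g := sum_range_succ _ _
  have lo_mono : Monotone lo := monotone_nat_of_le_succ fun g => by rw [lo_succ]; omega
  set col : ℕ → Finset ℕ := fun p => (range r).image fun a => a * m + p with hcol
  set blk : ℕ → Finset ℕ := fun g =>
    (Ico (lo g) (lo (g + 1)) ∩ range (r * m)) ∪ (E g).image (r * m + ·) with hblk
  have mem_blk {g t} : t ∈ blk g ↔
      (lo g ≤ t ∧ t < lo (g + 1) ∧ t < r * m) ∨ (r * m ≤ t ∧ t - r * m ∈ E g) := by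
    simp only [hblk, mem_union, mem_inter, mem_Ico, mem_range, mem_image, and_assoc]
    refine or_congr Iff.rfl ⟨?_, fun h => ⟨_, h.2, by omega⟩⟩
    rintro ⟨a, ha, rfl⟩
    exact ⟨by omega, by simpa using ha⟩
  have mem_col {p t} (hp : p < m) : t ∈ col p ↔ t < r * m ∧ t % m = p := by
    simp only [hcol, mem_image, mem_range]
    constructor
    · rintro ⟨a, ha, rfl⟩
      refine ⟨?_, ?_⟩
      · have : (a + 1) * m ≤ r * m := Nat.mul_le_mul_right m ha
        nlinarith
      · rw [Nat.mul_add_mod_of_lt hp]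
    · rintro ⟨h1, h2⟩
      refine ⟨t / m, Nat.div_lt_of_lt_mul (by rwa [mul_comm] at h1), ?_⟩
      rw [← h2, mul_comm]
      exact Nat.div_add_mod t m
  refine exists_batchCode_of_parityChecks hr (fun p => if p < m then col p else blk (p - m)) ?_ ?_
  · intro p hp
    split_ifs with h
    · exact card_image_le.trans (by simp)
    · refine (card_union_le _ _).trans (le_trans ?_ (hE (p - m) (by omega)))
      refine add_le_add ((card_le_card inter_subset_left).trans ?_) card_image_le
      rw [Nat.card_Ico, lo_succ]
      omega
  · intro t ht
    by_cases htm : t < r * m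
    · have hm : 0 < m := Nat.pos_of_ne_zero (by rintro rfl; simp at htm)
      have hex : ∃ g, t < lo (g + 1) := ⟨G, htm.trans_le (hsum.trans (lo_mono (Nat.le_succ G)))⟩
      set g := Nat.find hex with hg
      have hg1 : t < lo (g + 1) := Nat.find_spec hex
      have hg0 : lo g ≤ t := by
        rcases Nat.eq_zero_or_pos g with h | h
        · rw [h]
          simp [hlo]
        · have := Nat.find_min hex (m := g - 1) (by omega)
          rw [Nat.sub_add_cancel h] at this
          omega
      have hgG : g < G := by
        by_contra! h
        have := lo_mono h
        have : r * m ≤ lo G := hsum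
        omega
      refine ⟨t % m, by have := Nat.mod_lt t hm; omega, m + g, by omega,
        by have := Nat.mod_lt t hm; omega, ?_⟩
      have hlt := Nat.mod_lt t hm
      rw [if_pos hlt, if_neg (by omega), Nat.add_sub_cancel_left]
      ext u
      rw [mem_inter, mem_col hlt, mem_blk, mem_singleton]
      constructor
      · rintro ⟨⟨h1, h2⟩, h3⟩
        have h4 := hcm g hgG
        rw [lo_succ] at hg1 h3
        have h5 := Nat.div_add_mod u m
        have h6 := Nat.div_add_mod t m
        rcases lt_trichotomy (u / m) (t / m) with h | h | h
        · have := Nat.mul_le_mul_left m (Nat.succ_le_of_lt h)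
          rw [Nat.mul_succ] at this
          omega
        · rw [h, h2] at h5
          omega
        · have := Nat.mul_le_mul_left m (Nat.succ_le_of_lt h)
          rw [Nat.mul_succ] at this
          omega
      · rintro rfl
        exact ⟨⟨htm, rfl⟩, Or.inl ⟨hg0, hg1, htm⟩⟩
    · obtain ⟨g, hg, g', hg', hne, hgg⟩ := hcov (t - r * m) (by omega)
      refine ⟨m + g, by omega, m + g', by omega, by omega, ?_⟩
      rw [if_neg (by omega), if_neg (by omega), Nat.add_sub_cancel_left, Nat.add_sub_cancel_left]
      ext u
      have hu : u - r * m ∈ E g ∩ E g' ↔ u - r * m = t - r * m := by rw [hgg, mem_singleton]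
      rw [mem_inter] at hu
      rw [mem_inter, mem_blk, mem_blk, mem_singleton]
      constructor
      · rintro ⟨h1 | h1, h2 | h2⟩
        · rcases lt_or_gt_of_ne hne with h | h
          · have := lo_mono (Nat.succ_le_of_lt h)
            simp only [Nat.succ_eq_add_one] at this
            omega
          · have := lo_mono (Nat.succ_le_of_lt h)
            simp only [Nat.succ_eq_add_one] at this
            omega
        · omega
        · omega
        · have := hu.1 ⟨h1.2, h2.2⟩
          omega
      · rintro rfl
        have := hu.2 rfl
        exact ⟨Or.inr ⟨by omega, this.1⟩, Or.inr ⟨by omega, this.2⟩⟩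

theorem exists_batchCode_of_dvd {k r : ℕ} (hr : 1 ≤ r) (h : r ∣ k) :
    ∃ C : (Fin k → ZMod 2) →ₗ[ZMod 2] (Fin ((r + 1) * (k / r) + max (k / r) r) → ZMod 2),
      IsSystematic C ∧ IsBatchCode r 3 C := by
  obtain ⟨m, rfl⟩ := h
  rw [Nat.mul_div_cancel_left m (by omega)]
  have := exists_batchCode_of_blocks (r := r) (m := m) (s := 0) (G := max m r) hr
    (fun _ => min m r) (fun _ _ => min_le_left _ _)
    (by simp [mul_comm r m, max_mul_min]) (fun _ => ∅) (by simp) (by simp)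
  rw [show (r + 1) * m + max m r = r * m + 0 + (m + max m r) by ring]
  exact this

open Finset in
theorem exists_batchCode_of_not_dvd {k r : ℕ} (hr : 1 ≤ r) :
    ∃ C : (Fin k → ZMod 2) →ₗ[ZMod 2]
        (Fin ((r + 1) * (k / r) + 2 * (k % r) + 1 +
          (k - k % r - min (r - k % r) (k / r) - min (r - 1) (k / r) * (k % r) +
            min r (k / r) - 1) / min r (k / r)) → ZMod 2),
      IsSystematic C ∧ IsBatchCode r 3 C := by
  have hsr : k % r < r := Nat.mod_lt k hr
  have hk : k = r * (k / r) + k % r := (Nat.div_add_mod k r).symm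
  generalize k / r = m at *
  generalize k % r = s at *
  subst hk
  rw [Nat.add_sub_cancel]
  set N := (r * m - min (r - s) m - min (r - 1) m * s + min r m - 1) / min r m with hN
  have hcap : r * m ≤ min (r - s) m + min (r - 1) m * s + N * min r m := by
    rcases Nat.eq_zero_or_pos m with rfl | hm
    · simp
    · have hpos : 0 < min r m := lt_min hr hm
      have h1 := Nat.lt_div_mul_add (a := r * m - min (r - s) m - min (r - 1) m * s + min r m - 1)
        hpos
      rw [← hN] at h1
      omega
  clear_value N
  have := exists_batchCode_of_blocks (r := r) (m := m) (s := s) (G := 1 + s + N) hr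
    (fun g => if g = 0 then min (r - s) m else if g ≤ s then min (r - 1) m else min r m)
    (fun g _ => by split_ifs <;> exact min_le_right _ _)
    (by
      rw [sum_range_add, sum_range_add]
      have h1 : ∀ g ∈ range s, (if 1 + g = 0 then min (r - s) m else
          if 1 + g ≤ s then min (r - 1) m else min r m) = min (r - 1) m := fun g hg => by
        have := mem_range.1 hg
        rw [if_neg (by omega), if_pos (by omega)]
      have h2 : ∀ g ∈ range N, (if 1 + s + g = 0 then min (r - s) m else
          if 1 + s + g ≤ s then min (r - 1) m else min r m) = min r m := fun g _ => by
        rw [if_neg (by omega), if_neg (by omega)]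
      rw [sum_congr rfl h1, sum_congr rfl h2]
      simpa [mul_comm s] using hcap)
    (fun g => if g = 0 then range s else if g ≤ s then {g - 1} else ∅)
    (fun g _ => by
      have h1 := min_le_left (r - s) m
      have h2 := min_le_left (r - 1) m
      have h3 := min_le_left r m
      split_ifs <;> simp only [card_range, card_singleton, card_empty] <;> omega)
    (fun j hj => ⟨0, by omega, 1 + j, by omega, by omega, by
      rw [if_pos rfl, if_neg (by omega), if_pos (by omega), Nat.add_sub_cancel_left]
      exact inter_eq_right.2 (by simpa using hj)⟩)
  rw [show (r + 1) * m + 2 * s + 1 + N = r * m + s + (m + (1 + s + N)) by ring]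
  exact this

/-- Bounds on the optimal length `B(k,r,3)` of systematic linear binary batch codes with
`t = 3` and `r ≥ 3`: the lower bound `k + 1 + ⌈(2k−1)/(2r−1)⌉ ≤ B(k,r,3)`, the upper
bound `B(k,r,3) ≤ (r+1)(k/r) + max {k/r, r}` when `r | k`, and the upper bound
`B(k,r,3) ≤ (r+1)⌊k/r⌋ + 2s + 1 + ⌈(k − s − τ − ηs)/γ⌉` when `r ∤ k`, where
`s = k mod r`, `τ = min {r−s, ⌊k/r⌋}`, `η = min {r−1, ⌊k/r⌋}`, `γ = min {r, ⌊k/r⌋}`. -/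
theorem batch_length_bounds_t_three (k r : ℕ) (hk : 1 ≤ k) (hr : 3 ≤ r) :
    k + 1 + (2 * k - 1 + (2 * r - 1) - 1) / (2 * r - 1) ≤
      sInf {n : ℕ | ∃ C : (Fin k → ZMod 2) →ₗ[ZMod 2] (Fin n → ZMod 2),
        IsSystematic C ∧ IsBatchCode r 3 C} ∧
    (r ∣ k →
      sInf {n : ℕ | ∃ C : (Fin k → ZMod 2) →ₗ[ZMod 2] (Fin n → ZMod 2),
          IsSystematic C ∧ IsBatchCode r 3 C} ≤
        (r + 1) * (k / r) + max (k / r) r) ∧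
    (¬ r ∣ k →
      sInf {n : ℕ | ∃ C : (Fin k → ZMod 2) →ₗ[ZMod 2] (Fin n → ZMod 2),
          IsSystematic C ∧ IsBatchCode r 3 C} ≤
        (r + 1) * (k / r) + 2 * (k % r) + 1 +
          (k - k % r - min (r - k % r) (k / r) - min (r - 1) (k / r) * (k % r) +
            min r (k / r) - 1) / min r (k / r)) := by
  refine ⟨le_csInf ?_ ?_, fun h => Nat.sInf_le (exists_batchCode_of_dvd (by omega) h),
    fun _ => Nat.sInf_le (exists_batchCode_of_not_dvd (by omega))⟩
  · exact ⟨_, exists_batchCode_of_not_dvd (by omega)⟩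
  · rintro n ⟨C, hs, hC⟩
    have h := hC.length_lower_bound hk (by omega) hs
    obtain ⟨c, hc⟩ : ∃ c, c = 2 * r - 1 := ⟨_, rfl⟩
    rw [← hc] at h ⊢
    have hcpos : 0 < c := by omega
    have hn : k + 1 ≤ n := by
      by_contra! hlt
      have := Nat.mul_le_mul_left c (Nat.le_of_lt_succ hlt)
      omega
    obtain ⟨d, rfl⟩ := Nat.exists_eq_add_of_le hn
    have hd : 2 * k - 1 ≤ c * d := by nlinarith
    have : (2 * k - 1 + c - 1) / c < d + 1 := by
      rw [Nat.div_lt_iff_lt_mul hcpos]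
      have : (d + 1) * c = c * d + c := by ring
      omega
    omega
end
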